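/- Let f : 𝔸 → 𝔸 be a positive twist map with no conjugate points and F a lift of f. Define X⁻ = {(x,y) ∈ ℝ² : Ψ₁(x) < y < Ψ₋₁(x)} and X⁺ = {(x,y) ∈ ℝ² : Ψ₋₁(x) < y < Ψ₁(x)}. Then the sets Fⁿ(X⁻), n ∈ ℤ, are pairwise disjoint, and the sets Fⁿ(X⁺), n ∈ ℤ, are pairwise disjoint; moreover ⋃_{n∈ℤ} Fⁿ(X⁻) and ⋃_{n∈ℤ} Fⁿ(X⁺) are disjoint. -/

import Mathlib

noncomputable section

open MeasureTheory Set Filter Topology Function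

/-- The annulus `𝔸 = (ℝ/ℤ) × ℝ`. -/
abbrev Ann : Type := AddCircle (1 : ℝ) × ℝ

/-- The plane `ℝ²`, universal cover of the annulus. -/
abbrev Pl : Type := ℝ × ℝ

/-- The covering projection `π : ℝ² → 𝔸`, `π(x,y) = (x + ℤ, y)`. -/
def pr : Pl → Ann := fun p => ((p.1 : AddCircle (1 : ℝ)), p.2)

/-- The vertical vector `v = (0,1)`. -/
def vv : Pl := (0, 1)

/-- Data of a `C¹` diffeomorphism `f` of the annulus, isotopic to the identity,
presented through a lifted isotopy `(Ft t)_{t ∈ [0,1]}` of `C¹` diffeomorphisms of the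
plane commuting with the deck transformation, with `Ft 0 = id` and `Ft 1` a lift of `f`,
whose derivatives depend continuously on `(t, z)`. -/
structure IsotopySetup where
  f : Ann → Ann
  Ft : ℝ → Pl → Pl
  lift_f : ∀ p, pr (Ft 1 p) = f (pr p)
  Ft_zero : Ft 0 = id
  Ft_periodic : ∀ t, ∀ p : Pl, Ft t (p + (1, 0)) = Ft t p + (1, 0)
  Ft_smooth : ∀ t ∈ Icc (0:ℝ) 1, ContDiff ℝ 1 (Ft t)
  Ft_diffeo : ∀ t ∈ Icc (0:ℝ) 1, ∃ G : Pl → Pl, ContDiff ℝ 1 G ∧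
      Function.LeftInverse G (Ft t) ∧ Function.RightInverse G (Ft t)
  Ft_cont : ContinuousOn (fun q : ℝ × Pl => Ft q.1 q.2) (Icc (0:ℝ) 1 ×ˢ univ)
  DFt_cont : ContinuousOn (fun q : ℝ × Pl => fderiv ℝ (Ft q.1) q.2) (Icc (0:ℝ) 1 ×ˢ univ)

namespace IsotopySetup

variable (S : IsotopySetup)

/-- The canonical lift `F : ℝ² → ℝ²` of `f`. -/
def F : Pl → Pl := S.Ft 1

/-- The extended linearized isotopy: for `t ≥ 0`, `D t p` is the derivative at `p` of the
extended isotopy `f_t`, determined by `Df_{n+s} = Df_s ∘ Df^n` for `n ∈ ℕ`, `s ∈ [0,1)`. -/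
def D (t : ℝ) (p : Pl) : Pl →L[ℝ] Pl :=
  (fderiv ℝ (S.Ft (Int.fract t)) (S.F^[⌊t⌋₊] p)).comp (fderiv ℝ (S.F^[⌊t⌋₊]) p)

/-- `S.AngleVar p w n a` : the total angular variation on `[0,n]` of the vector `w ∈ T_{π(p)}𝔸`
under the extended linearized isotopy equals `a`; that is, `a = n·Torsionₙ(f, π(p), w)`.
Here `Θ` is a continuous lift of the angle `≺(v, Df_t(z)w)` (so that the direction of
`Df_t(z)w` is `(−sin(2πΘ(t)), cos(2πΘ(t)))`). -/
def AngleVar (p w : Pl) (n : ℕ) (a : ℝ) : Prop :=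
  ∃ Θ : ℝ → ℝ, ContinuousOn Θ (Icc 0 (n:ℝ)) ∧
    (∀ t ∈ Icc (0:ℝ) (n:ℝ), ∃ r : ℝ, 0 < r ∧
      S.D t p w = r • (-Real.sin (2 * Real.pi * Θ t), Real.cos (2 * Real.pi * Θ t))) ∧
    a = Θ n - Θ 0

/-- `S.TorsionFin p w n τ` : the finite-time torsion `Torsionₙ(f, π(p), w)` equals `τ`. -/
def TorsionFin (p w : Pl) (n : ℕ) (τ : ℝ) : Prop :=
  ∃ a : ℝ, S.AngleVar p w n a ∧ τ = a / n

/-- The asymptotic torsion at the lifted point `p` exists and equals `L`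
(for every choice of nonzero tangent vector `w`). -/
def TorsionLift (p : Pl) (L : ℝ) : Prop :=
  ∀ w : Pl, w ≠ 0 → ∃ a : ℕ → ℝ, (∀ n : ℕ, 1 ≤ n → S.AngleVar p w n (a n)) ∧
    Tendsto (fun n : ℕ => a n / (n : ℝ)) atTop (nhds L)

/-- The asymptotic torsion at `z ∈ 𝔸` exists and equals `L`. -/
def Torsion (z : Ann) (L : ℝ) : Prop :=
  ∃ p : Pl, pr p = z ∧ S.TorsionLift p L

open Classical in
/-- The asymptotic torsion as a function on the annulus (defaulting to `0` where undefined). -/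
def torsionFun (z : Ann) : ℝ :=
  if h : ∃ L, S.Torsion z L then h.choose else 0

/-- The lifted point `p` has conjugate points: `n·Torsionₙ(f,z,v) = −k/2` for some `n,k ≥ 1`. -/
def ConjLift (p : Pl) : Prop :=
  ∃ n k : ℕ, 1 ≤ n ∧ 1 ≤ k ∧ ∃ a : ℝ, S.AngleVar p vv n a ∧ a = -(k : ℝ) / 2

/-- The lifted point `p` has over-conjugate points: `n·Torsionₙ(f,z,v) < −1/2` for some `n ≥ 1`. -/
def OverConjLift (p : Pl) : Prop :=
  ∃ n : ℕ, 1 ≤ n ∧ ∃ a : ℝ, S.AngleVar p vv n a ∧ a < -(1:ℝ) / 2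

/-- The point `z ∈ 𝔸` has conjugate points. -/
def Conj (z : Ann) : Prop := ∃ p : Pl, pr p = z ∧ S.ConjLift p

/-- The point `z ∈ 𝔸` has over-conjugate points. -/
def OverConj (z : Ann) : Prop := ∃ p : Pl, pr p = z ∧ S.OverConjLift p

/-- `f` is a positive twist map: for every `x`, the map `y ↦ p₁(F(x,y))` is an increasing
diffeomorphism of `ℝ` onto `ℝ`. -/
def PosTwist : Prop :=
  ∀ x : ℝ, StrictMono (fun y => (S.F (x, y)).1) ∧
    Function.Surjective (fun y => (S.F (x, y)).1) ∧
    ∀ y : ℝ, 0 < deriv (fun y => (S.F (x, y)).1) y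

/-- `f` has no conjugate points (linearized-dynamics formulation): for every `z ∈ ℝ²` and
`n ≥ 1`, the first component of `DFⁿ(z)(0,1)` does not vanish. -/
def NoConjPts : Prop :=
  ∀ p : Pl, ∀ n : ℕ, 1 ≤ n → ((fderiv ℝ (S.F^[n]) p) (0, 1)).1 ≠ 0

/-- `f` is exact symplectic: it preserves the Lebesgue measure and `F*(y dx) − y dx = dS`
for a `C¹` function `S : ℝ² → ℝ` with `S(x+1,y) = S(x,y)`. -/
def ExactSymplectic : Prop :=
  MeasurePreserving S.f volume volume ∧
  ∃ Sg : Pl → ℝ, ContDiff ℝ 1 Sg ∧ (∀ p : Pl, Sg (p + (1, 0)) = Sg p) ∧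
    ∀ p : Pl,
      fderiv ℝ Sg p (1, 0) = (S.F p).2 * (fderiv ℝ S.F p (1, 0)).1 - p.2 ∧
      fderiv ℝ Sg p (0, 1) = (S.F p).2 * (fderiv ℝ S.F p (0, 1)).1

end IsotopySetup

/-- `γ` is an essential curve of the annulus: a topological embedding of the circle which is
not homotopic to a constant map. -/
def EssentialCurve (γ : C(AddCircle (1:ℝ), Ann)) : Prop :=
  Topology.IsEmbedding γ ∧ ∀ z : Ann, ¬ γ.Homotopic (ContinuousMap.const _ z)

/-- An open subset of the annulus is essential if it contains an essential curve. -/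
def EssentialSet (U : Set Ann) : Prop :=
  ∃ γ : C(AddCircle (1:ℝ), Ann), EssentialCurve γ ∧ range γ ⊆ U

/-- `f` restricted to `U` is `C⁰`-integrable: `U` is the disjoint union of a family of
`f`-invariant images of essential curves. -/
def C0IntegrableOn (f : Ann → Ann) (U : Set Ann) : Prop :=
  ∃ (ι : Type) (γ : ι → C(AddCircle (1:ℝ), Ann)),
    (∀ i, EssentialCurve (γ i) ∧ f '' range (γ i) = range (γ i)) ∧
    (⋃ i, range (γ i)) = U ∧
    Pairwise (Disjoint on fun i => range (γ i))

/-- `ℤ`-iterates of a bijection (negative iterates through the inverse map). -/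
def iterZ {α : Type*} [Nonempty α] (f : α → α) : ℤ → α → α
  | Int.ofNat n => f^[n]
  | Int.negSucc n => (Function.invFun f)^[n + 1]

/-- `ℐ(f)`: the union of all `f`-invariant essential curves. -/
def invCurveUnion (f : Ann → Ann) : Set Ann :=
  ⋃ γ ∈ {γ : C(AddCircle (1:ℝ), Ann) | EssentialCurve γ ∧ f '' range γ = range γ}, range γ



namespace TwistAux

/-- Order-theoretic core data. -/
structure Core (F G : Pl → Pl) : Prop where
  gf : ∀ z, G (F z) = z
  fg : ∀ z, F (G z) = z
  per : ∀ p : Pl, F (p + (1, 0)) = F p + (1, 0)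
  mono : ∀ x, StrictMono (fun y => (F (x, y)).1)
  surj : ∀ x, Function.Surjective (fun y => (F (x, y)).1)
  anti : ∀ x, StrictAnti (fun y => (G (x, y)).1)
  cont : Continuous F
  inj : ∀ n : ℕ, ∀ x, Function.Injective (fun y => (F^[n+1] (x, y)).1)

variable {F G : Pl → Pl}

theorem per_iter (h : Core F G) (n : ℕ) (p : Pl) : F^[n] (p + (1,0)) = F^[n] p + (1,0) := by
  induction n generalizing p with
  | zero => rfl
  | succ k ih => rw [Function.iterate_succ_apply, h.per, ih, ← Function.iterate_succ_apply]

theorem below (h : Core F G) {A B : Pl} (h1 : (F A).1 = (F B).1) (h2 : B.1 < A.1) :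
    (F A).2 < (F B).2 := by
  by_contra hc
  push Not at hc
  have := (h.anti (F A).1).antitone hc
  have e1 : (((F A).1, (F B).2) : Pl) = F B := by rw [h1]
  have e2 : (((F A).1, (F A).2) : Pl) = F A := rfl
  simp only [e1, e2, h.gf] at this
  linarith

theorem mono_iter (h : Core F G) (n : ℕ) : ∀ x, StrictMono (fun y => (F^[n+1] (x, y)).1) := by
  induction n with
  | zero => simpa using h.mono
  | succ k ih =>
    intro x
    have hc : Continuous (fun y : ℝ => (F^[k+1+1] (x, y)).1) :=
      continuous_fst.comp ((h.cont.iterate _).comp (by fun_prop))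
    rcases hc.strictMono_of_inj (h.inj (k+1) x) with hm | ha
    · exact hm
    · exfalso
      obtain ⟨t, ht⟩ := h.surj x ((F (x, 0)).1 + 1)
      simp only at ht
      have ht0 : 0 < t := by
        rw [← (h.mono x).lt_iff_lt]
        simp only [ht]; linarith
      have hlt := ha ht0
      simp only at hlt
      have hZ : (F ((x, 0) + (1, 0))).1 = (F (x, t)).1 := by
        rw [h.per, ht]; simp
      have hb := below h hZ (by simp)
      have := ih (F (x,t)).1 hb
      have e1 : (((F (x,t)).1, (F ((x,0)+(1,0))).2) : Pl) = F ((x,0)+(1,0)) := by rw [← hZ]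
      have e2 : (((F (x,t)).1, (F (x,t)).2) : Pl) = F (x,t) := rfl
      simp only [e1, e2] at this
      rw [← Function.iterate_succ_apply, ← Function.iterate_succ_apply, per_iter h] at this
      simp only [Prod.fst_add] at this
      linarith

theorem cross (h : Core F G) {X Y : Pl} (h1 : Y.1 < X.1) (h2 : (F X).1 < (F Y).1) (n : ℕ) :
    (F^[n+1] X).1 < (F^[n+1] Y).1 := by
  obtain ⟨t, ht⟩ := h.surj X.1 (F Y).1
  simp only at ht
  have ht0 : X.2 < t := by
    rw [← (h.mono X.1).lt_iff_lt]
    simp only [ht]; exact h2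
  have a1 := mono_iter h n X.1 ht0
  simp only at a1
  have hb := below h ht h1
  have a2 : (F^[n+1] (X.1, t)).1 ≤ (F^[n+1] Y).1 := by
    rcases n with _ | k
    · exact ht.le
    · have := mono_iter h k (F Y).1 hb
      have e1 : (((F Y).1, (F (X.1,t)).2) : Pl) = F (X.1,t) := by rw [← ht]
      simp only [e1] at this
      exact this.le
  exact lt_of_lt_of_le a1 a2

theorem after_min (h : Core F G) {z : Pl} (h1 : z.1 < (F z).1) (h2 : z.1 < (G z).1) (n : ℕ) :
    (F^[n] z).1 < (F^[n+1] z).1 := by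
  have := cross h (X := G z) (Y := z) h2 (by rwa [h.fg]) n
  rwa [Function.iterate_succ_apply, h.fg] at this

theorem after_max (h : Core F G) {z : Pl} (h1 : (F z).1 < z.1) (h2 : (G z).1 < z.1) (n : ℕ) :
    (F^[n+1] z).1 < (F^[n] z).1 := by
  have := cross h (X := z) (Y := G z) h2 (by rwa [h.fg]) n
  rwa [Function.iterate_succ_apply (x := G z), h.fg] at this

theorem g_iter (h : Core F G) (k : ℕ) (z : Pl) : G (F^[k+1] z) = F^[k] z := by
  rw [Function.iterate_succ_apply', h.gf]

theorem lin_aux (A B : Pl →L[ℝ] Pl) (hAB : ∀ v, A (B v) = v) :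
    ((A (1,0)).1 * (A (0,1)).2 - (A (0,1)).1 * (A (1,0)).2 ≠ 0) ∧
    ((A (1,0)).1 * (A (0,1)).2 - (A (0,1)).1 * (A (1,0)).2) * (B (0,1)).1 = - (A (0,1)).1 := by
  have key : ∀ v : Pl, A v = v.1 • A (1,0) + v.2 • A (0,1) := by
    intro v
    rw [← map_smul, ← map_smul, ← map_add]
    congr 1
    ext <;> simp
  have e1 := hAB (0,1)
  have e2 := hAB (1,0)
  rw [key] at e1 e2
  simp only [Prod.ext_iff, Prod.fst_add, Prod.snd_add, Prod.smul_fst, Prod.smul_snd,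
    smul_eq_mul] at e1 e2
  obtain ⟨e11, e12⟩ := e1
  obtain ⟨e21, e22⟩ := e2
  generalize (A (1,0)).1 = a at *
  generalize (A (1,0)).2 = c at *
  generalize (A (0,1)).1 = b at *
  generalize (A (0,1)).2 = d at *
  generalize (B (0,1)).1 = p at *
  generalize (B (0,1)).2 = q at *
  generalize (B (1,0)).1 = r at *
  generalize (B (1,0)).2 = s at *
  constructor
  · intro h0
    have : (a*d - b*c) * (r*q - s*p) = 1 := by
      linear_combination (c*r+d*s)*(-1)*e11 + (a*r+b*s)*e12 + e21
    rw [h0] at this; simp at this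
  · linear_combination d*e11 - b*e12

theorem inv_comp {f g : Pl → Pl} (hf : Differentiable ℝ f) (hg : Differentiable ℝ g)
    (h1 : ∀ z, g (f z) = z) (h2 : ∀ z, f (g z) = z) (z v : Pl) :
    fderiv ℝ f z (fderiv ℝ g (f z) v) = v := by
  have a := (hf (g (f z))).hasFDerivAt.comp (f z) (hg (f z)).hasFDerivAt
  have : f ∘ g = id := funext h2
  rw [this] at a
  have := a.unique (hasFDerivAt_id _)
  rw [h1] at this
  exact congrArg (fun L => L v) this

theorem det_pos (S : IsotopySetup) (z : Pl) :
    0 < (fderiv ℝ (S.Ft 1) z (1,0)).1 * (fderiv ℝ (S.Ft 1) z (0,1)).2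
      - (fderiv ℝ (S.Ft 1) z (0,1)).1 * (fderiv ℝ (S.Ft 1) z (1,0)).2 := by
  set δ : ℝ → ℝ := fun t => (fderiv ℝ (S.Ft t) z (1,0)).1 * (fderiv ℝ (S.Ft t) z (0,1)).2
      - (fderiv ℝ (S.Ft t) z (0,1)).1 * (fderiv ℝ (S.Ft t) z (1,0)).2 with hδ
  have hne : ∀ t ∈ Icc (0:ℝ) 1, δ t ≠ 0 := by
    intro t ht
    obtain ⟨G, hG, hl, hr⟩ := S.Ft_diffeo t ht
    exact (lin_aux _ (fderiv ℝ G (S.Ft t z)) (fun v => inv_comp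
      ((S.Ft_smooth t ht).differentiable one_ne_zero) (hG.differentiable one_ne_zero)
      hl hr z v)).1
  have hD : ContinuousOn (fun t : ℝ => fderiv ℝ (S.Ft t) z) (Icc 0 1) :=
    S.DFt_cont.comp (f := fun t : ℝ => (t, z)) (by fun_prop) (fun t ht => ⟨ht, mem_univ _⟩)
  have hv : ∀ v : Pl, ContinuousOn (fun t : ℝ => fderiv ℝ (S.Ft t) z v) (Icc 0 1) :=
    fun v => hD.clm_apply continuousOn_const
  have hc : ContinuousOn δ (Icc 0 1) :=
    ((hv (1,0)).fst.mul (hv (0,1)).snd).sub ((hv (0,1)).fst.mul (hv (1,0)).snd)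
  have h0 : δ 0 = 1 := by simp [hδ, S.Ft_zero]
  by_contra hcon
  have h1 : δ 1 ≤ 0 := not_lt.mp hcon
  have := intermediate_value_Icc' (zero_le_one) hc
  obtain ⟨t, ht, h⟩ := this ⟨h1, by rw [h0]; exact zero_le_one⟩
  exact hne t ht h

theorem hasDerivAt_vert {f : Pl → Pl} (hf : Differentiable ℝ f) (x y : ℝ) :
    HasDerivAt (fun y => (f (x, y)).1) (fderiv ℝ f (x, y) (0,1)).1 y := by
  have h1 : HasDerivAt (fun y : ℝ => ((x, y) : Pl)) (0, 1) y :=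
    (hasDerivAt_const y x).prodMk (hasDerivAt_id y)
  have h2 : HasDerivAt (fun y => f (x, y)) (fderiv ℝ f (x, y) (0,1)) y :=
    (hf (x, y)).hasFDerivAt.comp_hasDerivAt y h1
  exact (ContinuousLinearMap.fst ℝ ℝ ℝ).hasFDerivAt.comp_hasDerivAt y h2

theorem core (S : IsotopySetup) (htwist : S.PosTwist) (hnc : S.NoConjPts) :
    Core S.F (Function.invFun S.F) := by
  obtain ⟨G, hG, hl, hr⟩ := S.Ft_diffeo 1 (by simp)
  have hFs : ContDiff ℝ 1 S.F := S.Ft_smooth 1 (by simp)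
  have hFd := hFs.differentiable one_ne_zero
  have hGd := hG.differentiable one_ne_zero
  have hinj : Function.Injective S.F := Function.LeftInverse.injective hl
  have hGeq : Function.invFun S.F = G := by
    funext z
    apply hinj
    rw [show S.F (G z) = z from hr z]
    exact Function.invFun_eq ⟨G z, hr z⟩
  rw [hGeq]
  have gf : ∀ z, G (S.F z) = z := hl
  have fg : ∀ z, S.F (G z) = z := hr
  refine ⟨gf, fg, S.Ft_periodic 1, fun x => (htwist x).1, fun x => (htwist x).2.1, ?_,
    hFs.continuous, ?_⟩
  · intro x
    have hin : Function.Injective (fun y => (G (x, y)).1) := by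
      intro y y' hy
      simp only at hy
      have e : G (x, y) = G (x, y') := by
        apply Prod.ext hy
        apply (htwist (G (x,y)).1).1.injective
        have e2 : (((G (x,y)).1, (G (x,y')).2) : Pl) = G (x, y') := by rw [hy]
        simp only [e2, fg, Prod.mk.eta]
      have := congrArg S.F e
      rw [fg, fg] at this
      exact congrArg Prod.snd this
    have hc : Continuous (fun y : ℝ => (G (x, y)).1) :=
      continuous_fst.comp (hG.continuous.comp (by fun_prop))
    rcases hc.strictMono_of_inj hin with hm | ha
    · exfalso
      have hd := (hasDerivAt_vert hGd x 0).deriv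
      have hnn := hm.monotone.deriv_nonneg (x := 0)
      rw [hd] at hnn
      have hdet := det_pos S (G (x, 0))
      have hl2 := (lin_aux (fderiv ℝ S.F (G (x,0))) (fderiv ℝ G (x,0)) (fun v => by
        have := inv_comp hFd hGd gf fg (G (x,0)) v
        rwa [fg] at this)).2
      have hb := (htwist (G (x,0)).1).2.2 (G (x,0)).2
      rw [(hasDerivAt_vert hFd _ _).deriv, Prod.mk.eta] at hb
      have := mul_nonneg hdet.le hnn
      change 0 ≤ ((fderiv ℝ S.F (G (x,0)) (1,0)).1 * (fderiv ℝ S.F (G (x,0)) (0,1)).2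
        - (fderiv ℝ S.F (G (x,0)) (0,1)).1 * (fderiv ℝ S.F (G (x,0)) (1,0)).2)
        * (fderiv ℝ G (x,0) (0,1)).1 at this
      rw [hl2] at this
      linarith
    · exact ha
  · intro n x
    have hit : Differentiable ℝ (S.F^[n+1]) := hFd.iterate _
    have hd := hasDerivAt_vert hit x
    have key : ∀ a b : ℝ, a < b → (S.F^[n+1] (x, a)).1 ≠ (S.F^[n+1] (x, b)).1 := by
      intro a b hab he
      obtain ⟨c, -, hc⟩ := exists_hasDerivAt_eq_zero hab
        (fun y _ => (hd y).continuousAt.continuousWithinAt) he (fun y _ => hd y)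
      exact hnc (x, c) (n+1) (by omega) hc
    intro a b hab
    rcases lt_trichotomy a b with h | h | h
    · exact absurd hab (key a b h)
    · exact h
    · exact absurd hab.symm (key b a h)

/-- The permutation given by `F`. -/
def perm (h : Core F G) : Equiv.Perm Pl := ⟨F, G, h.gf, h.fg⟩

theorem perm_pow (h : Core F G) (n : ℕ) (z : Pl) : ((perm h) ^ n) z = F^[n] z := by
  rw [← Equiv.Perm.iterate_eq_pow]; rfl

theorem iterZ_eq (h : Core F (Function.invFun F)) (n : ℤ) (z : Pl) :
    iterZ F n z = ((perm h) ^ n) z := by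
  rcases n with n | n
  · simp only [Int.ofNat_eq_natCast, zpow_natCast, perm_pow h]; rfl
  · rw [zpow_negSucc, ← inv_pow, ← Equiv.Perm.iterate_eq_pow]; rfl

theorem collide (h : Core F (Function.invFun F)) {m n : ℤ} (hmn : m < n) {z w : Pl}
    (he : iterZ F m z = iterZ F n w) : ∃ k : ℕ, z = F^[k+1] w := by
  rw [iterZ_eq h, iterZ_eq h] at he
  refine ⟨(n - m - 1).toNat, ?_⟩
  rw [← perm_pow h, ← zpow_natCast]
  have : (((n - m - 1).toNat + 1 : ℕ) : ℤ) = -m + n := by omega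
  rw [this, zpow_add, Equiv.Perm.mul_apply, ← he, ← Equiv.Perm.mul_apply, ← zpow_add]
  simp

end TwistAux

/-- For a positive twist map with no conjugate points, with
`X⁻ = {(x,y) : Ψ₁(x) < y < Ψ₋₁(x)}` and `X⁺ = {(x,y) : Ψ₋₁(x) < y < Ψ₁(x)}` (here `Ψm`
plays the role of `Ψ₋₁`), the sets `Fⁿ(X⁻)`, `n ∈ ℤ`, are pairwise disjoint, as are the sets
`Fⁿ(X⁺)`, `n ∈ ℤ`; moreover `⋃ₙ Fⁿ(X⁻)` and `⋃ₙ Fⁿ(X⁺)` are disjoint. -/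
theorem statement15 (S : IsotopySetup) (htwist : S.PosTwist) (hnc : S.NoConjPts)
    (Ψ₁ Ψm : ℝ → ℝ) (hΨ₁C : ContDiff ℝ 1 Ψ₁) (hΨmC : ContDiff ℝ 1 Ψm)
    (hΨ₁per : ∀ x : ℝ, Ψ₁ (x + 1) = Ψ₁ x) (hΨmper : ∀ x : ℝ, Ψm (x + 1) = Ψm x)
    (hΨ₁ : ∀ p : Pl, (S.F p).1 = p.1 ↔ p.2 = Ψ₁ p.1)
    (hΨm : ∀ p : Pl, (Function.invFun S.F p).1 = p.1 ↔ p.2 = Ψm p.1) :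
    (∀ m n : ℤ, m ≠ n →
      Disjoint (iterZ S.F m '' {z : Pl | Ψ₁ z.1 < z.2 ∧ z.2 < Ψm z.1})
               (iterZ S.F n '' {z : Pl | Ψ₁ z.1 < z.2 ∧ z.2 < Ψm z.1})) ∧
    (∀ m n : ℤ, m ≠ n →
      Disjoint (iterZ S.F m '' {z : Pl | Ψm z.1 < z.2 ∧ z.2 < Ψ₁ z.1})
               (iterZ S.F n '' {z : Pl | Ψm z.1 < z.2 ∧ z.2 < Ψ₁ z.1})) ∧
    Disjoint (⋃ n : ℤ, iterZ S.F n '' {z : Pl | Ψ₁ z.1 < z.2 ∧ z.2 < Ψm z.1})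
             (⋃ n : ℤ, iterZ S.F n '' {z : Pl | Ψm z.1 < z.2 ∧ z.2 < Ψ₁ z.1}) := by
  have h := TwistAux.core S htwist hnc
  set G := Function.invFun S.F with hG
  have hmin : ∀ z : Pl, Ψ₁ z.1 < z.2 ∧ z.2 < Ψm z.1 → z.1 < (S.F z).1 ∧ z.1 < (G z).1 := by
    intro z hz
    have e1 : (S.F (z.1, Ψ₁ z.1)).1 = z.1 := (hΨ₁ (z.1, Ψ₁ z.1)).2 rfl
    have e2 : (G (z.1, Ψm z.1)).1 = z.1 := (hΨm (z.1, Ψm z.1)).2 rfl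
    have a1 := h.mono z.1 hz.1
    have a2 := h.anti z.1 hz.2
    simp only [e1, e2, Prod.mk.eta] at a1 a2
    exact ⟨a1, a2⟩
  have hmax : ∀ z : Pl, Ψm z.1 < z.2 ∧ z.2 < Ψ₁ z.1 → (S.F z).1 < z.1 ∧ (G z).1 < z.1 := by
    intro z hz
    have e1 : (S.F (z.1, Ψ₁ z.1)).1 = z.1 := (hΨ₁ (z.1, Ψ₁ z.1)).2 rfl
    have e2 : (G (z.1, Ψm z.1)).1 = z.1 := (hΨm (z.1, Ψm z.1)).2 rfl
    have a1 := h.mono z.1 hz.2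
    have a2 := h.anti z.1 hz.1
    simp only [e1, e2, Prod.mk.eta] at a1 a2
    exact ⟨a1, a2⟩
  -- after a strict local minimum `w`, no later point is a local extremum
  have noMin : ∀ w : Pl, (Ψ₁ w.1 < w.2 ∧ w.2 < Ψm w.1) → ∀ k : ℕ,
      (G (S.F^[k+1] w)).1 < (S.F^[k+1] w).1 ∧ (S.F^[k+1] w).1 < (S.F (S.F^[k+1] w)).1 := by
    intro w hw k
    have a := TwistAux.after_min h (hmin w hw).1 (hmin w hw).2
    rw [TwistAux.g_iter h, ← Function.iterate_succ_apply' S.F (k+1) w]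
    exact ⟨a k, a (k+1)⟩
  have noMax : ∀ w : Pl, (Ψm w.1 < w.2 ∧ w.2 < Ψ₁ w.1) → ∀ k : ℕ,
      (S.F^[k+1] w).1 < (G (S.F^[k+1] w)).1 ∧ (S.F (S.F^[k+1] w)).1 < (S.F^[k+1] w).1 := by
    intro w hw k
    have a := TwistAux.after_max h (hmax w hw).1 (hmax w hw).2
    rw [TwistAux.g_iter h, ← Function.iterate_succ_apply' S.F (k+1) w]
    exact ⟨a k, a (k+1)⟩
  have mm : ∀ m n : ℤ, m < n → ∀ z w : Pl, (Ψ₁ z.1 < z.2 ∧ z.2 < Ψm z.1) →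
      (Ψ₁ w.1 < w.2 ∧ w.2 < Ψm w.1) → iterZ S.F m z ≠ iterZ S.F n w := by
    intro m n hmn z w hz hw he
    obtain ⟨k, rfl⟩ := TwistAux.collide h hmn he
    have := (noMin w hw k).1
    have := (hmin _ hz).2
    linarith
  have MM : ∀ m n : ℤ, m < n → ∀ z w : Pl, (Ψm z.1 < z.2 ∧ z.2 < Ψ₁ z.1) →
      (Ψm w.1 < w.2 ∧ w.2 < Ψ₁ w.1) → iterZ S.F m z ≠ iterZ S.F n w := by
    intro m n hmn z w hz hw he
    obtain ⟨k, rfl⟩ := TwistAux.collide h hmn he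
    have := (noMax w hw k).1
    have := (hmax _ hz).2
    linarith
  refine ⟨?_, ?_, ?_⟩
  · intro m n hmn
    rw [Set.disjoint_left]
    rintro _ ⟨z, hz, rfl⟩ ⟨w, hw, he⟩
    rcases lt_or_gt_of_ne hmn with hlt | hlt
    · exact mm m n hlt z w hz hw he.symm
    · exact mm n m hlt w z hw hz he
  · intro m n hmn
    rw [Set.disjoint_left]
    rintro _ ⟨z, hz, rfl⟩ ⟨w, hw, he⟩
    rcases lt_or_gt_of_ne hmn with hlt | hlt
    · exact MM m n hlt z w hz hw he.symm
    · exact MM n m hlt w z hw hz he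
  · rw [Set.disjoint_left]
    intro p hp hq
    obtain ⟨m, z, hz, rfl⟩ := Set.mem_iUnion.1 hp
    obtain ⟨n, w, hw, he⟩ := Set.mem_iUnion.1 hq
    rcases lt_trichotomy m n with hlt | heq | hlt
    · obtain ⟨k, rfl⟩ := TwistAux.collide h hlt he.symm
      have := (noMax w hw k).2
      have := (hmin _ hz).1
      linarith
    · subst heq
      rw [TwistAux.iterZ_eq h, TwistAux.iterZ_eq h] at he
      have := (TwistAux.perm h ^ m).injective he
      subst this
      exact absurd (hmin _ hz).1 (not_lt.2 (hmax _ hw).1.le)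
    · obtain ⟨k, rfl⟩ := TwistAux.collide h hlt he
      have := (noMin z hz k).2
      have := (hmax _ hw).1
      linarith

end
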